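/- arXiv:1308.1243 — 2 statements merged into one kernel-verified Lean document; each statement's English description precedes it below -/
import Mathlib

section
/- For natural numbers m < n, the standard geometric embedding η : B_m → B_n, i.e., the group homomorphism determined by η(σ_i) = σ_i for i = 1, …, m−1, is injective. -/
/-- The braid relations on generators `σ_1, …, σ_{n-1}`, indexed here by `Fin (n-1)`
(index `i : Fin (n-1)` corresponds to `σ_{i+1}`): far-apart generators commute, and
adjacent generators satisfy the braid relation. -/
def braidRels (n : ℕ) : Set (FreeGroup (Fin (n - 1))) :=
  { r | (∃ i j : Fin (n - 1), (i : ℕ) + 1 < (j : ℕ) ∧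
          r = FreeGroup.of i * FreeGroup.of j * (FreeGroup.of i)⁻¹ * (FreeGroup.of j)⁻¹) ∨
        (∃ i j : Fin (n - 1), (j : ℕ) = (i : ℕ) + 1 ∧
          r = FreeGroup.of i * FreeGroup.of j * FreeGroup.of i *
              (FreeGroup.of j * FreeGroup.of i * FreeGroup.of j)⁻¹) }

/-- The braid group `B_n` on `n` strands, presented by generators and braid relations. -/
abbrev BraidGroup (n : ℕ) : Type := PresentedGroup (braidRels n)

/-- The Artin generator `σ_{i+1}` of `B_n`, for `i : Fin (n-1)`. -/
def braidGen (n : ℕ) (i : Fin (n - 1)) : BraidGroup n := PresentedGroup.of i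

/-- A family of elements satisfying the braid relations defines a homomorphism out of `B_n`. -/
theorem BraidGroup.exists_hom {G : Type*} [Group G] (n : ℕ) (f : ℕ → G)
    (hcomm : ∀ i j, i + 1 < j → j < n - 1 → f i * f j = f j * f i)
    (hbraid : ∀ i, i + 1 < n - 1 → f i * f (i + 1) * f i = f (i + 1) * f i * f (i + 1)) :
    ∃ φ : BraidGroup n →* G, ∀ i : Fin (n - 1), φ (braidGen n i) = f i := by
  have hrel : ∀ r ∈ braidRels n, FreeGroup.lift (fun i : Fin (n - 1) => f i) r = 1 := by
    rintro r (⟨i, j, hij, rfl⟩ | ⟨i, j, hij, rfl⟩)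
    · simp [hcomm i j hij j.2]
    · have h := hbraid i (hij ▸ j.2)
      simp only [map_mul, map_inv, FreeGroup.lift_apply_of, hij]
      rw [h, mul_inv_cancel]
  exact ⟨PresentedGroup.toGroup hrel, fun i => PresentedGroup.toGroup.of hrel⟩

theorem BraidGroup.induction {n : ℕ} {p : BraidGroup n → Prop} (gen : ∀ i, p (braidGen n i))
    (one : p 1) (mul : ∀ x y, p x → p y → p (x * y)) (inv : ∀ x, p x → p x⁻¹)
    (x : BraidGroup n) : p x := by
  have hx : x ∈ Subgroup.closure (Set.range (PresentedGroup.of (rels := braidRels n))) := by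
    rw [PresentedGroup.closure_range_of]
    trivial
  induction hx using Subgroup.closure_induction with
  | mem x hx => obtain ⟨i, rfl⟩ := hx; exact gen i
  | one => exact one
  | mul x y _ _ hx hy => exact mul x y hx hy
  | inv x _ hx => exact inv x hx

theorem braidGen_comm (n : ℕ) (i j : Fin (n - 1)) (hij : (i : ℕ) + 1 < j) :
    braidGen n i * braidGen n j = braidGen n j * braidGen n i := by
  have h : PresentedGroup.mk (braidRels n) _ = 1 :=
    PresentedGroup.one_of_mem (Or.inl ⟨i, j, hij, rfl⟩)
  simp only [map_mul, map_inv] at h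
  exact mul_inv_eq_iff_eq_mul.mp (mul_inv_eq_one.mp h)

theorem braidGen_braid (n : ℕ) (i j : Fin (n - 1)) (hij : (j : ℕ) = i + 1) :
    braidGen n i * braidGen n j * braidGen n i = braidGen n j * braidGen n i * braidGen n j := by
  have h : PresentedGroup.mk (braidRels n) _ = 1 :=
    PresentedGroup.one_of_mem (Or.inr ⟨i, j, hij, rfl⟩)
  simp only [map_mul, map_inv] at h
  exact mul_inv_eq_one.mp h

/-- The Artin generators of `B_n` indexed by all natural numbers, trivial out of range. -/
def braidGenNat (n i : ℕ) : BraidGroup n :=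
  if h : i < n - 1 then braidGen n ⟨i, h⟩ else 1

theorem braidGenNat_coe (n : ℕ) (i : Fin (n - 1)) : braidGenNat n i = braidGen n i := by
  simp [braidGenNat]

theorem braidGenNat_comm (n i j : ℕ) (hij : i + 1 < j) :
    braidGenNat n i * braidGenNat n j = braidGenNat n j * braidGenNat n i := by
  unfold braidGenNat
  split_ifs
  · exact braidGen_comm n _ _ hij
  all_goals simp

theorem braidGenNat_braid (n i : ℕ) (hi : i + 1 < n - 1) :
    braidGenNat n i * braidGenNat n (i + 1) * braidGenNat n i =
      braidGenNat n (i + 1) * braidGenNat n i * braidGenNat n (i + 1) := by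
  have hi' : i < n - 1 := by omega
  simp only [braidGenNat, hi, hi', dif_pos]
  exact braidGen_braid n _ _ rfl

/-- What remains of the crossing `i` of `n + 1` strands after deleting the strand at position `k`;
trivial if there is no such strand. -/
def deletedCrossing (n i k : ℕ) : BraidGroup n :=
  if n < k ∨ k = i ∨ k = i + 1 then 1
  else if i < k then braidGenNat n i else braidGenNat n (i - 1)

/-- The crossing `i` acting on pairs of a braid and the position of a deleted strand. -/
def deletionPerm (n i : ℕ) : Equiv.Perm (BraidGroup n × ℕ) where
  toFun x := (deletedCrossing n i x.2 * x.1, Equiv.swap i (i + 1) x.2)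
  invFun x := ((deletedCrossing n i (Equiv.swap i (i + 1) x.2))⁻¹ * x.1,
    Equiv.swap i (i + 1) x.2)
  left_inv x := by simp
  right_inv x := by simp

theorem deletionPerm_apply (n i : ℕ) (g : BraidGroup n) (k : ℕ) :
    deletionPerm n i (g, k) = (deletedCrossing n i k * g, Equiv.swap i (i + 1) k) := rfl

theorem deletionPerm_comm (n i j : ℕ) (hij : i + 1 < j) (hj : j < n) :
    deletionPerm n i * deletionPerm n j = deletionPerm n j * deletionPerm n i := by
  ext1 ⟨g, k⟩
  simp only [Equiv.Perm.mul_apply, deletionPerm_apply, ← mul_assoc, Prod.mk.injEq,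
    mul_left_inj]
  have h₁ := braidGenNat_comm n i j hij
  have h₂ := braidGenNat_comm n (i - 1) (j - 1)
  have h₃ := braidGenNat_comm n i (j - 1)
  simp only [Equiv.swap_apply_def, deletedCrossing]
  grind

theorem deletionPerm_braid (n i : ℕ) (hi : i + 1 < n) :
    deletionPerm n i * deletionPerm n (i + 1) * deletionPerm n i =
      deletionPerm n (i + 1) * deletionPerm n i * deletionPerm n (i + 1) := by
  ext1 ⟨g, k⟩
  simp only [Equiv.Perm.mul_apply, deletionPerm_apply, ← mul_assoc, Prod.mk.injEq,
    mul_left_inj]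
  have h₁ := braidGenNat_braid n i
  have h₂ := braidGenNat_braid n (i - 1)
  simp only [Equiv.swap_apply_def, deletedCrossing]
  obtain hk | rfl | rfl | rfl | hk : k < i ∨ k = i ∨ k = i + 1 ∨ k = i + 2 ∨ i + 2 < k := by omega
  all_goals grind

theorem standard_embedding_succ_injective (n : ℕ) (ι : BraidGroup n →* BraidGroup (n + 1))
    (hι : ∀ i : Fin (n - 1), ι (braidGen n i) = braidGen (n + 1) (Fin.castLE (by omega) i)) :
    Function.Injective ι := by
  obtain ⟨φ, hφ⟩ := BraidGroup.exists_hom (n + 1) (deletionPerm n)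
    (deletionPerm_comm n) (deletionPerm_braid n)
  have key : ∀ w g : BraidGroup n, φ (ι w) (g, n) = (w * g, n) := by
    intro w
    induction w using BraidGroup.induction with
    | gen i =>
      intro g
      have h₁ : ¬ (n < n ∨ n = (i : ℕ) ∨ n = (i : ℕ) + 1) := by omega
      have h₂ : (i : ℕ) < n := by omega
      rw [hι, hφ, Fin.val_castLE, deletionPerm_apply, deletedCrossing, if_neg h₁, if_pos h₂,
        braidGenNat_coe, Equiv.swap_apply_of_ne_of_ne (by omega) (by omega)]
    | one => simp
    | mul x y hx hy => intro g; simp [hx, hy, mul_assoc]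
    | inv x hx =>
      intro g
      rw [map_inv, map_inv, Equiv.Perm.inv_eq_iff_eq, hx, mul_inv_cancel_left]
  intro x y hxy
  have h := key x 1
  rw [hxy, key y 1] at h
  simpa using (congrArg Prod.fst h).symm

theorem exists_injective_standard_embedding {m n : ℕ} (hmn : m ≤ n) :
    ∃ η : BraidGroup m →* BraidGroup n, Function.Injective η ∧
      ∀ i : Fin (m - 1), η (braidGen m i) = braidGen n (Fin.castLE (by omega) i) := by
  induction n, hmn using Nat.le_induction with
  | base => exact ⟨MonoidHom.id _, Function.injective_id, fun i => rfl⟩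
  | succ n hmn ih =>
    obtain ⟨η, hinj, hη⟩ := ih
    obtain ⟨ι, hι⟩ := BraidGroup.exists_hom n (braidGenNat (n + 1))
      (fun i j hij _ => braidGenNat_comm _ i j hij)
      (fun i hi => braidGenNat_braid _ i (by omega))
    have hι' : ∀ i : Fin (n - 1),
        ι (braidGen n i) = braidGen (n + 1) (Fin.castLE (by omega) i) := fun i => by
      rw [hι, ← braidGenNat_coe, Fin.val_castLE]
    refine ⟨ι.comp η, (standard_embedding_succ_injective n ι hι').comp hinj, fun i => ?_⟩
    rw [MonoidHom.comp_apply, hη, hι']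
    rfl

/-- The standard geometric embedding `η : B_m → B_n` (the unique homomorphism with
`η(σ_i) = σ_i` for `i = 1, …, m-1`) is injective. -/
theorem standard_geometric_embedding_injective (m n : ℕ) (hmn : m < n)
    (η : BraidGroup m →* BraidGroup n)
    (hη : ∀ i : Fin (m - 1),
      η (braidGen m i) = braidGen n (Fin.castLE (by omega) i)) :
    Function.Injective η := by
  obtain ⟨η', hinj, hη'⟩ := exists_injective_standard_embedding hmn.le
  have h : η = η' := PresentedGroup.ext fun i => (hη i).trans (hη' i).symm
  exact h ▸ hinj
end

section
/- Let m < n be natural numbers and let η : B_m → B_n be the standard geometric embedding. For every a, b ∈ B_m, if η(a) and η(b) are conjugate in B_n (i.e., there exists α ∈ B_n with α·η(a)·α⁻¹ = η(b)), then a and b are conjugate in B_m. -/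
namespace BraidGroup

/-- The generator `σ_{k+1}` of `B_n` indexed by a natural number, and `1` out of range. -/
def natGen (n k : ℕ) : BraidGroup n :=
  if h : k < n - 1 then braidGen n ⟨k, h⟩ else 1

theorem natGen_val {n : ℕ} (i : Fin (n - 1)) : natGen n i = braidGen n i := by
  simp [natGen]

theorem braidGen_comm {n : ℕ} {i j : Fin (n - 1)} (h : (i : ℕ) + 1 < j) :
    braidGen n i * braidGen n j = braidGen n j * braidGen n i := by
  have := PresentedGroup.one_of_mem (rels := braidRels n) (Or.inl ⟨i, j, h, rfl⟩)
  simp only [map_mul, map_inv] at this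
  rwa [mul_inv_eq_one, mul_inv_eq_iff_eq_mul] at this

theorem braidGen_braid {n : ℕ} {i j : Fin (n - 1)} (h : (j : ℕ) = i + 1) :
    braidGen n i * braidGen n j * braidGen n i = braidGen n j * braidGen n i * braidGen n j := by
  have := PresentedGroup.one_of_mem (rels := braidRels n) (Or.inr ⟨i, j, h, rfl⟩)
  simp only [map_mul, map_inv] at this
  rwa [mul_inv_eq_one] at this

theorem natGen_comm (n : ℕ) {i j : ℕ} (h : i + 1 < j) :
    natGen n i * natGen n j = natGen n j * natGen n i := by
  unfold natGen
  split_ifs with h1 h2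
  · exact braidGen_comm h
  all_goals simp

theorem natGen_braid {n i : ℕ} (h : i + 1 < n - 1) :
    natGen n i * natGen n (i + 1) * natGen n i =
      natGen n (i + 1) * natGen n i * natGen n (i + 1) := by
  have h' : i < n - 1 := by omega
  rw [natGen, natGen, dif_pos h, dif_pos h']
  exact braidGen_braid rfl

/-- A homomorphism out of `B_n` from elements satisfying the braid relations. -/
def lift {G : Type*} [Group G] (n : ℕ) (f : Fin (n - 1) → G)
    (hcomm : ∀ i j : Fin (n - 1), (i : ℕ) + 1 < j → f i * f j = f j * f i)
    (hbraid : ∀ i j : Fin (n - 1), (j : ℕ) = i + 1 → f i * f j * f i = f j * f i * f j) :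
    BraidGroup n →* G :=
  PresentedGroup.toGroup (f := f) (rels := braidRels n) (by
    rintro r (⟨i, j, h, rfl⟩ | ⟨i, j, h, rfl⟩)
    · simp only [map_mul, map_inv, FreeGroup.lift_apply_of]
      rw [mul_inv_eq_one, mul_inv_eq_iff_eq_mul, hcomm i j h]
    · simp only [map_mul, map_inv, FreeGroup.lift_apply_of]
      rw [mul_inv_eq_one, hbraid i j h])

@[simp]
theorem lift_braidGen {G : Type*} [Group G] {n : ℕ} {f : Fin (n - 1) → G} {hcomm hbraid}
    (i : Fin (n - 1)) : lift n f hcomm hbraid (braidGen n i) = f i :=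
  PresentedGroup.toGroup.of _

@[elab_as_elim]
theorem gen_induction {n : ℕ} {P : BraidGroup n → Prop} (x : BraidGroup n)
    (gen : ∀ i, P (braidGen n i)) (one : P 1) (mul : ∀ x y, P x → P y → P (x * y))
    (inv : ∀ x, P x → P x⁻¹) : P x := by
  have hx : x ∈ Subgroup.closure (Set.range (PresentedGroup.of (rels := braidRels n))) := by
    rw [PresentedGroup.closure_range_of]
    trivial
  induction hx using Subgroup.closure_induction with
  | mem y hy => obtain ⟨i, rfl⟩ := hy; exact gen i
  | one => exact one
  | mul x y _ _ hx hy => exact mul x y hx hy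
  | inv x _ hx => exact inv x hx

/-- The standard embedding `B_m → B_n` for `m ≤ n`. -/
def emb {m n : ℕ} (h : m ≤ n) : BraidGroup m →* BraidGroup n :=
  lift m (fun i => braidGen n (Fin.castLE (by omega) i))
    (fun _ _ hij => braidGen_comm hij) (fun _ _ hij => braidGen_braid hij)

theorem emb_braidGen {m n : ℕ} (h : m ≤ n) (i : Fin (m - 1)) :
    emb h (braidGen m i) = braidGen n (Fin.castLE (by omega) i) :=
  lift_braidGen i

theorem emb_natGen {m n : ℕ} (h : m ≤ n) {k : ℕ} (hk : k < m - 1) :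
    emb h (natGen m k) = natGen n k := by
  have hk' : k < n - 1 := by omega
  simp [natGen, hk, hk', emb_braidGen]

/-- The action of a braid on strand positions, numbered from `0`, fixing all positions `≥ n`. -/
def pos (n : ℕ) : BraidGroup n →* Equiv.Perm ℕ :=
  lift n (fun i => Equiv.swap (i : ℕ) (i + 1))
    (by
      intro i j h
      ext p
      simp only [Equiv.Perm.mul_apply, Equiv.swap_apply_def]
      grind)
    (by
      intro i j h
      ext p
      simp only [Equiv.Perm.mul_apply, Equiv.swap_apply_def]
      grind)

theorem pos_natGen {n k : ℕ} (hk : k < n - 1) : pos n (natGen n k) = Equiv.swap k (k + 1) := by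
  simp [natGen, hk, pos]

theorem pos_eq_self {n : ℕ} (x : BraidGroup n) {p : ℕ} (hp : n ≤ p) : pos n x p = p := by
  induction x using gen_induction with
  | gen i =>
    rw [← natGen_val, pos_natGen i.2]
    exact Equiv.swap_apply_of_ne_of_ne (by omega) (by omega)
  | one => simp
  | mul x y hx hy => rw [map_mul, Equiv.Perm.mul_apply, hy, hx]
  | inv x hx => rw [map_inv, Equiv.Perm.inv_eq_iff_eq, hx]

theorem pos_lt {n : ℕ} (x : BraidGroup n) {p : ℕ} (hp : p < n) : pos n x p < n := by
  by_contra! h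
  have := (pos n x).injective (pos_eq_self x h)
  omega

theorem pos_emb {m n : ℕ} (h : m ≤ n) (x : BraidGroup m) : pos n (emb h x) = pos m x := by
  induction x using gen_induction with
  | gen i => rw [← natGen_val, emb_natGen h i.2, pos_natGen i.2, pos_natGen (by omega)]
  | one => simp
  | mul x y hx hy => rw [map_mul, map_mul, map_mul, hx, hy]
  | inv x hx => rw [map_inv, map_inv, map_inv, hx]

/-- The braid on `m` strands left from the generator `σ_{k+1}` of `B_{m+1}` after removing the
strand starting in position `p`. -/
def delGen (m k p : ℕ) : BraidGroup m :=
  if p < k then natGen m (k - 1) else if k + 1 < p ∧ p ≤ m then natGen m k else 1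

theorem delGen_swap (m k p : ℕ) : delGen m k (Equiv.swap k (k + 1) p) = delGen m k p := by
  rw [Equiv.swap_apply_def]
  unfold delGen
  grind

/-- A generator of `B_{m+1}` permutes pairs of a marked position and a braid on the remaining
strands. -/
def strandGen (m k : ℕ) : Equiv.Perm (ℕ × BraidGroup m) where
  toFun x := (Equiv.swap k (k + 1) x.1, delGen m k x.1 * x.2)
  invFun x := (Equiv.swap k (k + 1) x.1, (delGen m k x.1)⁻¹ * x.2)
  left_inv x := by simp [delGen_swap]
  right_inv x := by simp [delGen_swap]

theorem strandGen_apply (m k p : ℕ) (g : BraidGroup m) :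
    strandGen m k (p, g) = (Equiv.swap k (k + 1) p, delGen m k p * g) := rfl

theorem strandGen_comm (m : ℕ) {i j : ℕ} (h : i + 1 < j) (hj : j < m) :
    strandGen m i * strandGen m j = strandGen m j * strandGen m i := by
  have h1 := natGen_comm m h
  have h2 := natGen_comm m (i := i) (j := j - 1)
  have h3 := natGen_comm m (i := i - 1) (j := j - 1)
  ext1 ⟨p, g⟩
  simp only [Equiv.Perm.mul_apply, strandGen_apply, ← mul_assoc, Prod.mk.injEq, mul_left_inj,
    Equiv.swap_apply_def, delGen]
  grind (splits := 30)

theorem strandGen_braid (m : ℕ) {i : ℕ} (hi : i + 1 < m) :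
    strandGen m i * strandGen m (i + 1) * strandGen m i =
      strandGen m (i + 1) * strandGen m i * strandGen m (i + 1) := by
  have h1 : i + 2 < m → _ := fun h => natGen_braid (n := m) (i := i) (by omega)
  have h2 : 0 < i → _ := fun h => natGen_braid (n := m) (i := i - 1) (by omega)
  ext1 ⟨p, g⟩
  simp only [Equiv.Perm.mul_apply, strandGen_apply, ← mul_assoc, Prod.mk.injEq, mul_left_inj,
    Equiv.swap_apply_def, delGen]
  grind (splits := 30)

/-- The action of `B_{m+1}` on pairs of a marked position and a braid on the remaining strands. -/
def strand (m : ℕ) : BraidGroup (m + 1) →* Equiv.Perm (ℕ × BraidGroup m) :=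
  lift (m + 1) (fun i => strandGen m i)
    (fun i j h => strandGen_comm m h j.2)
    (fun i j h => by
      have := j.2
      simp only [h]
      exact strandGen_braid m (by omega))

/-- Remove from a braid the strand starting in position `p`. -/
def del {m : ℕ} (x : BraidGroup (m + 1)) (p : ℕ) : BraidGroup m := (strand m x (p, 1)).2

theorem strand_braidGen {m : ℕ} (i : Fin (m + 1 - 1)) :
    strand m (braidGen (m + 1) i) = strandGen m i := by
  simp [strand]

theorem strand_apply {m : ℕ} (x : BraidGroup (m + 1)) (p : ℕ) (g : BraidGroup m) :
    strand m x (p, g) = (pos (m + 1) x p, del x p * g) := by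
  induction x using gen_induction generalizing p g with
  | gen i =>
    rw [del, strand_braidGen, strandGen_apply, strandGen_apply, ← natGen_val, pos_natGen i.2,
      mul_one]
  | one => simp [del]
  | mul x y hx hy =>
    simp only [del, map_mul, Equiv.Perm.mul_apply]
    rw [hy p g, hy p 1, hx, hx]
    simp [mul_assoc]
  | inv x hx =>
    have key (g : BraidGroup m) : strand m x⁻¹ (p, g) =
        (pos (m + 1) x⁻¹ p, (del x (pos (m + 1) x⁻¹ p))⁻¹ * g) := by
      rw [map_inv, Equiv.Perm.inv_eq_iff_eq, hx]
      simp
    rw [del, key, key]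
    simp

theorem del_mul {m : ℕ} (x y : BraidGroup (m + 1)) (p : ℕ) :
    del (x * y) p = del x (pos (m + 1) y p) * del y p := by
  rw [del, map_mul, Equiv.Perm.mul_apply, strand_apply y, strand_apply x]
  simp

theorem del_one {m : ℕ} (p : ℕ) : del (1 : BraidGroup (m + 1)) p = 1 := by simp [del]

theorem del_inv {m : ℕ} (x : BraidGroup (m + 1)) (p : ℕ) :
    del x⁻¹ p = (del x (pos (m + 1) x⁻¹ p))⁻¹ := by
  have h := del_mul x x⁻¹ p
  rw [mul_inv_cancel, del_one] at h
  exact (inv_eq_of_mul_eq_one_right h.symm).symm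

theorem del_natGen {m k : ℕ} (hk : k < m) (p : ℕ) :
    del (natGen (m + 1) k) p = delGen m k p := by
  have : natGen (m + 1) k = braidGen (m + 1) ⟨k, hk⟩ := natGen_val (n := m + 1) ⟨k, hk⟩
  rw [this, del, strand_braidGen, strandGen_apply, mul_one]

/-- The increasing enumeration of the natural numbers other than `p`. -/
def skip (p q : ℕ) : ℕ := if q < p then q else q + 1

theorem pos_skip {m : ℕ} (x : BraidGroup (m + 1)) {p : ℕ} (hp : p < m + 1) (q : ℕ) :
    pos (m + 1) x (skip p q) = skip (pos (m + 1) x p) (pos m (del x p) q) := by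
  induction x using gen_induction generalizing p q with
  | gen i =>
    have hi : (i : ℕ) < m := i.2
    rw [← natGen_val, pos_natGen i.2, del_natGen hi, delGen]
    split_ifs with h1 h2
    · rw [pos_natGen (by omega)]
      simp only [Equiv.swap_apply_def, skip]
      grind
    · rw [pos_natGen (by omega)]
      simp only [Equiv.swap_apply_def, skip]
      grind
    · simp only [Equiv.swap_apply_def, skip, map_one, Equiv.Perm.one_apply]
      grind
  | one => simp [del_one]
  | mul x y hx hy =>
    rw [del_mul, map_mul, map_mul, Equiv.Perm.mul_apply, Equiv.Perm.mul_apply,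
      Equiv.Perm.mul_apply, hy hp, hx (pos_lt y hp)]
  | inv x hx =>
    rw [map_inv, Equiv.Perm.inv_eq_iff_eq, ← map_inv, hx (pos_lt x⁻¹ hp), del_inv]
    simp

theorem del_emb_last {m : ℕ} (x : BraidGroup m) : del (emb (m.le_add_right 1) x) m = x := by
  induction x using gen_induction with
  | gen i =>
    have := i.2
    rw [← natGen_val, emb_natGen _ i.2, del_natGen (by omega), delGen, if_neg (by omega),
      if_pos (by omega)]
  | one => simp [del_one]
  | mul x y hx hy => rw [map_mul, del_mul, pos_emb, pos_eq_self y le_rfl, hx, hy]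
  | inv x hx => rw [map_inv, del_inv, ← map_inv, pos_emb, pos_eq_self x⁻¹ le_rfl, hx]

theorem del_emb {m : ℕ} (x : BraidGroup (m + 1)) {p : ℕ} (hp : p < m + 1) :
    del (emb ((m + 1).le_add_right 1) x) p = emb (m.le_add_right 1) (del x p) := by
  induction x using gen_induction generalizing p with
  | gen i =>
    have hi : (i : ℕ) < m := i.2
    rw [← natGen_val, emb_natGen _ i.2, del_natGen (by omega), del_natGen hi, delGen, delGen]
    split_ifs
    any_goals omega
    · rw [emb_natGen _ (by omega)]
    · rw [emb_natGen _ (by omega)]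
    · simp
  | one => simp [del_one]
  | mul x y hx hy => rw [map_mul, del_mul, del_mul, pos_emb, hx (pos_lt y hp), hy hp, map_mul]
  | inv x hx =>
    rw [map_inv, del_inv, ← map_inv, pos_emb, hx (pos_lt x⁻¹ hp), del_inv,
      map_inv (emb (m.le_add_right 1))]

theorem isConj_of_isConj_emb_succ {m : ℕ} {a b : BraidGroup m}
    (h : IsConj (emb (m.le_add_right 1) a) (emb (m.le_add_right 1) b)) : IsConj a b := by
  obtain ⟨α, hα⟩ := isConj_iff.1 h
  replace hα : α * emb (m.le_add_right 1) a = emb (m.le_add_right 1) b * α :=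
    mul_inv_eq_iff_eq_mul.1 hα
  have hdel (q : ℕ) : del α (pos m a q) * del (emb (m.le_add_right 1) a) q =
      del (emb (m.le_add_right 1) b) (pos (m + 1) α q) * del α q := by
    have := congrArg (del · q) hα
    simpa only [del_mul, pos_emb] using this
  have hlast := hdel m
  rw [pos_eq_self a le_rfl, del_emb_last] at hlast
  obtain ⟨i, hi⟩ : ∃ i, pos (m + 1) α m = i := ⟨_, rfl⟩
  rw [hi] at hlast
  by_cases him : i = m
  · rw [him, del_emb_last] at hlast
    exact isConj_iff.2 ⟨_, mul_inv_eq_iff_eq_mul.2 hlast⟩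
  have hi_lt : i < m := by
    have : pos (m + 1) α m < m + 1 := pos_lt α m.lt_add_one
    omega
  obtain ⟨m, rfl⟩ : ∃ m', m = m' + 1 := ⟨m - 1, by omega⟩
  rw [del_emb b hi_lt] at hlast
  obtain ⟨j, hj⟩ : ∃ j, pos (m + 1 + 1) α j = m + 1 := (pos _ α).surjective _
  have hj_lt : j < m + 1 := by
    by_contra! hj'
    rcases hj'.eq_or_lt with rfl | hj'
    · exact him (hi.symm.trans hj)
    · have := pos_eq_self α hj'
      omega
  have haj : pos (m + 1) a j = j := by
    apply (pos _ α).injective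
    have := congrArg (pos _ · j) hα
    simp only [map_mul, Equiv.Perm.mul_apply, pos_emb] at this
    rw [this, hj, pos_eq_self b le_rfl]
  have hj_del := hdel j
  rw [haj, hj, del_emb_last, del_emb a hj_lt] at hj_del
  have hγ : pos (m + 1) (del α (m + 1)) j = m := by
    have := pos_skip α (m + 1).lt_add_one j
    rw [hi, skip, if_pos hj_lt, hj, skip] at this
    split_ifs at this <;> omega
  have hboth := congrArg (del · j) hlast
  simp only [del_mul, haj, hγ, del_emb_last] at hboth
  have h1 : IsConj a (emb (m.le_add_right 1) (del b i)) :=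
    isConj_iff.2 ⟨_, mul_inv_eq_iff_eq_mul.2 hlast⟩
  have h2 : IsConj (emb (m.le_add_right 1) (del a j)) b :=
    isConj_iff.2 ⟨_, mul_inv_eq_iff_eq_mul.2 hj_del⟩
  have h3 : IsConj (del a j) (del b i) :=
    isConj_iff.2 ⟨_, mul_inv_eq_iff_eq_mul.2 hboth⟩
  exact (h1.trans ((emb (m.le_add_right 1)).map_isConj h3).symm).trans h2

theorem emb_comp_succ {m n : ℕ} (h : m ≤ n) (x : BraidGroup m) :
    emb (h.trans (n.le_add_right 1)) x = emb (n.le_add_right 1) (emb h x) := by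
  induction x using gen_induction with
  | gen i =>
    rw [← natGen_val, emb_natGen _ i.2, emb_natGen _ i.2, emb_natGen _ (by omega)]
  | one => simp
  | mul x y hx hy => simp only [map_mul, hx, hy]
  | inv x hx => simp only [map_inv, hx]

theorem emb_refl {m : ℕ} (x : BraidGroup m) : emb le_rfl x = x := by
  induction x using gen_induction with
  | gen i => rw [← natGen_val, emb_natGen _ i.2]
  | one => simp
  | mul x y hx hy => simp only [map_mul, hx, hy]
  | inv x hx => simp only [map_inv, hx]

theorem isConj_of_isConj_emb {m n : ℕ} (h : m ≤ n) {a b : BraidGroup m}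
    (hab : IsConj (emb h a) (emb h b)) : IsConj a b := by
  induction n, h using Nat.le_induction with
  | base => simpa only [emb_refl] using hab
  | succ n h ih =>
    rw [emb_comp_succ h, emb_comp_succ h] at hab
    exact ih (isConj_of_isConj_emb_succ hab)

end BraidGroup

/-- The standard geometric embedding `η : B_m → B_n` does not merge conjugacy classes:
if `η(a)` and `η(b)` are conjugate in `B_n`, then `a` and `b` are conjugate in `B_m`. -/
theorem standard_geometric_embedding_not_merge_conj (m n : ℕ) (hmn : m < n)
    (η : BraidGroup m →* BraidGroup n)
    (hη : ∀ i : Fin (m - 1),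
      η (braidGen m i) = braidGen n (Fin.castLE (by omega) i))
    (a b : BraidGroup m)
    (h : ∃ α : BraidGroup n, α * η a * α⁻¹ = η b) :
    ∃ γ : BraidGroup m, γ * a * γ⁻¹ = b := by
  have hemb : η = BraidGroup.emb hmn.le :=
    PresentedGroup.ext fun i => (hη i).trans
      (BraidGroup.emb_braidGen hmn.le i).symm
  subst hemb
  exact isConj_iff.1 (BraidGroup.isConj_of_isConj_emb hmn.le (isConj_iff.2 h))
end
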